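/- arXiv:1211.2669 — 8 statements merged into one kernel-verified Lean document; each statement's English description precedes it below -/
import Mathlib

section
/- Let N ≥ 1, let p ∈ [1,2), and let U ∈ O(N) be a real orthogonal N×N matrix. Then ‖U‖_p = (Σ_{i,j}|U_{ij}|^p)^{1/p} ≤ N^{2/p − 1/2}, and equality holds if and only if |U_{ij}| = 1/√N for all i,j (equivalently, if and only if H = √N·U is a Hadamard matrix, i.e. has all entries ±1 and pairwise orthogonal rows). -/
open Matrix

theorem aux_entry (n p u : ℝ) (hn : 0 < n) (hp1 : 1 ≤ p) (hp2 : p < 2) :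
    |u| ^ p ≤ n ^ (-(p / 2)) * (1 + p / 2 * (n * u ^ 2 - 1)) ∧
    (|u| ^ p = n ^ (-(p / 2)) * (1 + p / 2 * (n * u ^ 2 - 1)) ↔ |u| = 1 / Real.sqrt n) := by
  have hpos : 0 < n ^ (-(p / 2)) := Real.rpow_pos_of_pos hn _
  have h1 : |u| ^ p = n ^ (-(p / 2)) * (1 + (n * u ^ 2 - 1)) ^ (p / 2) := by
    have e : (1 + (n * u ^ 2 - 1)) = n * |u| ^ (2 : ℝ) := by
      rw [Real.rpow_two, sq_abs]; ring
    rw [e, Real.mul_rpow hn.le (by positivity), ← mul_assoc, ← Real.rpow_add hn,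
      ← Real.rpow_mul (abs_nonneg u)]
    have : 2 * (p / 2) = p := by ring
    rw [this]; simp
  have hs : -1 ≤ n * u ^ 2 - 1 := by nlinarith [mul_nonneg hn.le (sq_nonneg u)]
  have hiff : |u| = 1 / Real.sqrt n ↔ n * u ^ 2 - 1 = 0 := by
    have hsq := Real.sqrt_pos.2 hn
    rw [← sq_abs u, ← sq_eq_sq₀ (abs_nonneg u) (by positivity), div_pow, Real.sq_sqrt hn.le,
      eq_div_iff hn.ne']
    constructor <;> intro h <;> linarith
  rw [h1, hiff]
  refine ⟨mul_le_mul_of_nonneg_left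
    (rpow_one_add_le_one_add_mul_self hs (by linarith) (by linarith)) hpos.le, ?_⟩
  constructor
  · intro h
    by_contra hne
    have := rpow_one_add_lt_one_add_mul_self hs hne (show 0 < p / 2 by linarith)
      (show p / 2 < 1 by linarith)
    exact this.ne (mul_left_cancel₀ hpos.ne' h)
  · intro h
    rw [h]; simp

/-- For `U ∈ O(N)` and `p ∈ [1,2)`, the `p`-norm satisfies
`‖U‖_p ≤ N^(2/p - 1/2)`, with equality iff all `|U_{ij}| = 1/√N`, equivalently
iff `H = √N·U` is a Hadamard matrix. -/
theorem stmt0 (N : ℕ) (hN : 1 ≤ N) (p : ℝ) (hp1 : 1 ≤ p) (hp2 : p < 2)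
    (U : Matrix (Fin N) (Fin N) ℝ) (hU : U * Uᵀ = 1) :
    (∑ i, ∑ j, |U i j| ^ p) ^ (1 / p) ≤ (N : ℝ) ^ (2 / p - 1 / 2) ∧
    ((∑ i, ∑ j, |U i j| ^ p) ^ (1 / p) = (N : ℝ) ^ (2 / p - 1 / 2) ↔
      ∀ i j, |U i j| = 1 / Real.sqrt N) ∧
    ((∑ i, ∑ j, |U i j| ^ p) ^ (1 / p) = (N : ℝ) ^ (2 / p - 1 / 2) ↔
      ((∀ i j, Real.sqrt N * U i j = 1 ∨ Real.sqrt N * U i j = -1) ∧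
        ∀ i j, i ≠ j →
          ∑ k, (Real.sqrt N * U i k) * (Real.sqrt N * U j k) = 0)) := by
  have hn : (0 : ℝ) < N := by exact_mod_cast hN
  have hsq : 0 < Real.sqrt N := Real.sqrt_pos.2 hn
  have hUU : ∀ i j, ∑ k, U i k * U j k = (1 : Matrix (Fin N) (Fin N) ℝ) i j := by
    intro i j
    rw [← hU]; simp [Matrix.mul_apply]
  have hrow : ∀ i, ∑ k, U i k ^ 2 = 1 := by
    intro i
    have := hUU i i
    simpa [sq] using this
  have hT : ∑ i, ∑ j, (N : ℝ) ^ (-(p / 2)) * (1 + p / 2 * (N * U i j ^ 2 - 1))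
      = (N : ℝ) ^ (2 - p / 2) := by
    have hr : ∀ i, ∑ j, (N : ℝ) ^ (-(p / 2)) * (1 + p / 2 * (N * U i j ^ 2 - 1))
        = (N : ℝ) ^ (-(p / 2)) * N := by
      intro i
      rw [← Finset.mul_sum, Finset.sum_add_distrib, ← Finset.mul_sum, Finset.sum_sub_distrib,
        ← Finset.mul_sum, hrow]
      simp
    simp only [hr]
    rw [sub_eq_add_neg, Real.rpow_add hn, Real.rpow_two]
    simp
    ring
  have hE := fun i j => aux_entry N p (U i j) hn hp1 hp2
  have hle : ∑ i, ∑ j, |U i j| ^ p ≤ (N : ℝ) ^ (2 - p / 2) := by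
    rw [← hT]
    exact Finset.sum_le_sum fun i _ => Finset.sum_le_sum fun j _ => (hE i j).1
  have heq : ∑ i, ∑ j, |U i j| ^ p = (N : ℝ) ^ (2 - p / 2) ↔
      ∀ i j, |U i j| = 1 / Real.sqrt N := by
    rw [← hT, Finset.sum_eq_sum_iff_of_le
      (fun i _ => Finset.sum_le_sum fun j _ => (hE i j).1)]
    refine forall_congr' fun i => ?_
    rw [Finset.sum_eq_sum_iff_of_le (fun j _ => (hE i j).1)]
    simp [(hE i _).2]
  have hS : 0 ≤ ∑ i, ∑ j, |U i j| ^ p := by positivity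
  have hp : 0 < 1 / p := by positivity
  have hR : (N : ℝ) ^ (2 / p - 1 / 2) = ((N : ℝ) ^ (2 - p / 2)) ^ (1 / p) := by
    rw [← Real.rpow_mul hn.le]
    congr 1
    field_simp
  have hmain : (∑ i, ∑ j, |U i j| ^ p) ^ (1 / p) = (N : ℝ) ^ (2 / p - 1 / 2) ↔
      ∀ i j, |U i j| = 1 / Real.sqrt N := by
    rw [hR, Real.rpow_left_inj hS (by positivity) hp.ne', heq]
  refine ⟨?_, hmain, ?_⟩
  · rw [hR]
    exact Real.rpow_le_rpow hS hle hp.le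
  · rw [hmain]
    have hc : ∀ i j, |U i j| = 1 / Real.sqrt N ↔
        (Real.sqrt N * U i j = 1 ∨ Real.sqrt N * U i j = -1) := by
      intro i j
      rw [← abs_eq zero_le_one, abs_mul, abs_of_pos hsq, eq_div_iff hsq.ne', mul_comm]
    simp only [hc]
    refine ⟨fun h => ⟨h, fun i j hij => ?_⟩, fun h => h.1⟩
    have : ∀ k, (Real.sqrt N * U i k) * (Real.sqrt N * U j k)
        = (Real.sqrt N * Real.sqrt N) * (U i k * U j k) := fun k => by ring
    simp only [this]
    rw [← Finset.mul_sum, hUU, Matrix.one_apply_ne hij, mul_zero]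
end

section
/- Let N ≥ 1, let p ∈ (2,∞), and let U ∈ O(N) be a real orthogonal N×N matrix. Then ‖U‖_p = (Σ_{i,j}|U_{ij}|^p)^{1/p} ≥ N^{2/p − 1/2}, and equality holds if and only if |U_{ij}| = 1/√N for all i,j (equivalently, if and only if H = √N·U is a Hadamard matrix). -/
open Matrix

/-- For `U ∈ O(N)` and `p ∈ (2,∞)`, the `p`-norm satisfies
`‖U‖_p ≥ N^(2/p - 1/2)`, with equality iff all `|U_{ij}| = 1/√N`, equivalently
iff `H = √N·U` is a Hadamard matrix. -/
theorem stmt1 (N : ℕ) (hN : 1 ≤ N) (p : ℝ) (hp : 2 < p)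
    (U : Matrix (Fin N) (Fin N) ℝ) (hU : U * Uᵀ = 1) :
    (N : ℝ) ^ (2 / p - 1 / 2) ≤ (∑ i, ∑ j, |U i j| ^ p) ^ (1 / p) ∧
    ((∑ i, ∑ j, |U i j| ^ p) ^ (1 / p) = (N : ℝ) ^ (2 / p - 1 / 2) ↔
      ∀ i j, |U i j| = 1 / Real.sqrt N) ∧
    ((∑ i, ∑ j, |U i j| ^ p) ^ (1 / p) = (N : ℝ) ^ (2 / p - 1 / 2) ↔
      ((∀ i j, Real.sqrt N * U i j = 1 ∨ Real.sqrt N * U i j = -1) ∧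
        ∀ i j, i ≠ j →
          ∑ k, (Real.sqrt N * U i k) * (Real.sqrt N * U j k) = 0)) := by
  have hN0 : (0 : ℝ) < N := by exact_mod_cast hN
  have hs0 : 0 < Real.sqrt N := Real.sqrt_pos.2 hN0
  have hs2 : Real.sqrt N * Real.sqrt N = N := Real.mul_self_sqrt hN0.le
  have hp0 : 0 < p := by linarith
  have hrow : ∀ i j, ∑ k, U i k * U j k = if i = j then 1 else 0 := by
    intro i j
    have := congrFun (congrFun hU i) j
    simpa [Matrix.mul_apply, Matrix.one_apply] using this
  have hterm : ∀ u : ℝ, (N : ℝ) ^ (p / 2) * |u| ^ p = (N * u ^ 2) ^ (p / 2) := by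
    intro u
    rw [Real.mul_rpow hN0.le (sq_nonneg u), ← sq_abs, ← Real.rpow_natCast,
      ← Real.rpow_mul (abs_nonneg u)]
    congr 2
    push_cast
    ring
  have hle : ∀ x : ℝ, 0 ≤ x → 1 + p / 2 * (x - 1) ≤ x ^ (p / 2) := by
    intro x hx
    have := one_add_mul_self_le_rpow_one_add (s := x - 1) (by linarith)
      (p := p / 2) (by linarith)
    simpa using this
  have hlt : ∀ x : ℝ, 0 ≤ x → 1 + p / 2 * (x - 1) = x ^ (p / 2) → x = 1 := by
    intro x hx h
    by_contra hne
    have := one_add_mul_self_lt_rpow_one_add (s := x - 1) (by linarith)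
      (sub_ne_zero.2 hne) (p := p / 2) (by linarith)
    rw [add_sub_cancel] at this
    linarith
  set S := ∑ i, ∑ j, |U i j| ^ p with hS
  have hS0 : 0 ≤ S := by positivity
  have hL : ∑ x : Fin N × Fin N, (1 + p / 2 * (N * U x.1 x.2 ^ 2 - 1)) = (N : ℝ) ^ 2 := by
    have h1 : ∑ x : Fin N × Fin N, U x.1 x.2 ^ 2 = (N : ℝ) := by
      rw [Fintype.sum_prod_type]
      simp only [pow_two, hrow]
      simp
    rw [Finset.sum_add_distrib, ← Finset.mul_sum, Finset.sum_sub_distrib, ← Finset.mul_sum, h1]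
    simp
    ring
  have hR : ∑ x : Fin N × Fin N, (N * U x.1 x.2 ^ 2) ^ (p / 2) = (N : ℝ) ^ (p / 2) * S := by
    simp only [← hterm]
    rw [← Finset.mul_sum, Fintype.sum_prod_type]
  have hpt : ∀ x ∈ (Finset.univ : Finset (Fin N × Fin N)),
      (1 + p / 2 * (N * U x.1 x.2 ^ 2 - 1)) ≤ (N * U x.1 x.2 ^ 2) ^ (p / 2) :=
    fun x _ => hle _ (by positivity)
  have hmain : (N : ℝ) ^ 2 ≤ (N : ℝ) ^ (p / 2) * S := by
    rw [← hL, ← hR]; exact Finset.sum_le_sum hpt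
  have hq : (0 : ℝ) < (N : ℝ) ^ (p / 2) := Real.rpow_pos_of_pos hN0 _
  have hA : (N : ℝ) ^ (p / 2) * (N : ℝ) ^ (2 - p / 2) = (N : ℝ) ^ 2 := by
    rw [← Real.rpow_add hN0, ← Real.rpow_natCast]
    congr 1
    push_cast
    ring
  have hA0 : (0 : ℝ) ≤ (N : ℝ) ^ (2 - p / 2) := (Real.rpow_pos_of_pos hN0 _).le
  have hB : (N : ℝ) ^ (2 / p - 1 / 2) = ((N : ℝ) ^ (2 - p / 2)) ^ (1 / p) := by
    rw [← Real.rpow_mul hN0.le]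
    congr 1
    field_simp
  have hSA : (N : ℝ) ^ (2 - p / 2) ≤ S := by
    rw [← hA] at hmain
    exact le_of_mul_le_mul_left hmain hq
  have habs : ∀ u : ℝ, |u| = 1 / Real.sqrt N ↔ N * u ^ 2 = 1 := by
    intro u
    rw [eq_div_iff hs0.ne', ← sq_abs]
    have := abs_nonneg u
    constructor
    · intro h
      linear_combination (|u| * √N + 1) * h - |u| ^ 2 * hs2
    · intro h
      have h' : (|u| * √N) ^ 2 = 1 := by linear_combination h + |u| ^ 2 * hs2
      have h0 := mul_nonneg this hs0.le
      rcases sq_eq_one_iff.1 h' with h1 | h1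
      · exact h1
      · linarith
  have hE : S ^ (1 / p) = (N : ℝ) ^ (2 / p - 1 / 2) ↔ ∀ i j, |U i j| = 1 / Real.sqrt N := by
    rw [hB, Real.rpow_left_inj hS0 hA0 (by positivity)]
    simp only [habs]
    rw [← mul_right_inj' hq.ne', hA, ← hL, ← hR, eq_comm, Finset.sum_eq_sum_iff_of_le hpt]
    constructor
    · intro h i j
      exact hlt _ (by positivity) (h (i, j) (Finset.mem_univ _))
    · intro h x _
      rw [h]; simp
  refine ⟨?_, hE, ?_⟩
  · rw [hB]
    exact Real.rpow_le_rpow hA0 hSA (by positivity)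
  · rw [hE]
    have hsq : ∀ u : ℝ, |u| = 1 / Real.sqrt N ↔ (√N * u = 1 ∨ √N * u = -1) := by
      intro u
      rw [habs, ← sq_eq_one_iff, mul_pow, Real.sq_sqrt hN0.le]
    simp only [hsq]
    refine ⟨fun h => ⟨h, fun i j hij => ?_⟩, fun h => h.1⟩
    have : ∑ k, (√N * U i k) * (√N * U j k) = N * ∑ k, U i k * U j k := by
      rw [Finset.mul_sum]
      refine Finset.sum_congr rfl fun k _ => ?_
      linear_combination (U i k * U j k) * hs2
    rw [this, hrow, if_neg hij, mul_zero]
end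

section
/- Let N ≥ 1 and let U ∈ M_N(ℝ), with indices in ℤ/Nℤ. The following are equivalent: (1) U is orthogonal, circulant, and symmetric; (2) U = F·diag(q)·F* for some vector q ∈ {±1}^N satisfying q_i = q_{−i} for all i ∈ ℤ/Nℤ, where F is the Fourier matrix. -/
open Matrix

/-- The rescaled Fourier matrix `F = (w^{jk}/√N)_{j,k ∈ ℤ/Nℤ}`, `w = e^{2πi/N}`. -/
noncomputable def Four (N : ℕ) [NeZero N] : Matrix (ZMod N) (ZMod N) ℂ :=
  Matrix.of fun j k =>
    Complex.exp (2 * (Real.pi : ℂ) * Complex.I * ((j.val * k.val : ℕ) : ℂ) / (N : ℂ)) /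
      (Real.sqrt N : ℂ)

lemma Four_apply (N : ℕ) [NeZero N] (j k : ZMod N) :
    Four N j k = ZMod.stdAddChar (j * k) / (Real.sqrt N : ℂ) := by
  have h : (j * k : ZMod N) = (((j.val * k.val : ℕ) : ℤ) : ZMod N) := by simp
  rw [h, ZMod.stdAddChar_coe]
  simp [Four]

lemma conj_std (N : ℕ) [NeZero N] (a : ZMod N) :
    (starRingEnd ℂ) (ZMod.stdAddChar a) = ZMod.stdAddChar (-a) := by
  rw [AddChar.map_neg_eq_conj]

lemma sqrt_sq' (N : ℕ) : (Real.sqrt N : ℂ) * (Real.sqrt N : ℂ) = N := by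
  rw [← Complex.ofReal_mul, Real.mul_self_sqrt (Nat.cast_nonneg N)]; simp

lemma FDF_apply (N : ℕ) [NeZero N] (d : ZMod N → ℂ) (i j : ZMod N) :
    (Four N * Matrix.diagonal d * (Four N)ᴴ) i j =
      (∑ k, d k * ZMod.stdAddChar (k * (i - j))) / N := by
  rw [Matrix.mul_apply, Finset.sum_div]
  refine Finset.sum_congr rfl fun k _ => ?_
  rw [Matrix.mul_diagonal, Matrix.conjTranspose_apply, Four_apply, Four_apply, ← sqrt_sq',
    Complex.star_def, map_div₀, conj_std, Complex.conj_ofReal,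
    show k * (i - j) = i * k + -(j * k) by ring, AddChar.map_add_eq_mul]
  ring

lemma FF (N : ℕ) [NeZero N] : Four N * (Four N)ᴴ = 1 := by
  ext i j
  have h := FDF_apply N (fun _ => 1) i j
  have hN : (N : ℂ) ≠ 0 := Nat.cast_ne_zero.2 (NeZero.ne N)
  rw [show (Matrix.diagonal fun _ : ZMod N => (1 : ℂ)) = 1 from Matrix.diagonal_one,
    Matrix.mul_one] at h
  rw [h]
  simp only [one_mul]
  rw [AddChar.sum_mulShift (i - j) (ZMod.isPrimitive_stdAddChar N), Matrix.one_apply]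
  by_cases hij : i = j
  · simp [hij, hN]
  · simp [hij, sub_eq_zero]

lemma FF' (N : ℕ) [NeZero N] : (Four N)ᴴ * Four N = 1 := mul_eq_one_comm.1 (FF N)

/-- A real matrix `U` is orthogonal, circulant and symmetric iff
`U = F·diag(q)·F*` for some sign vector `q ∈ {±1}^N` with `q_i = q_{-i}`. -/
theorem stmt5 (N : ℕ) [NeZero N] (U : Matrix (ZMod N) (ZMod N) ℝ) :
    (U * Uᵀ = 1 ∧ (∃ γ : ZMod N → ℝ, ∀ i j, U i j = γ (j - i)) ∧ Uᵀ = U) ↔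
    (∃ q : ZMod N → ℝ, (∀ i, q i = 1 ∨ q i = -1) ∧ (∀ i, q i = q (-i)) ∧
      U.map (Complex.ofReal) =
        Four N * Matrix.diagonal (fun k => (q k : ℂ)) * (Four N)ᴴ) := by
  have hmul : ∀ A B : Matrix (ZMod N) (ZMod N) ℝ,
      (A * B).map Complex.ofReal = A.map Complex.ofReal * B.map Complex.ofReal := fun A B =>
    Matrix.map_mul (f := Complex.ofRealHom)
  have hone : (1 : Matrix (ZMod N) (ZMod N) ℝ).map Complex.ofReal = 1 :=
    Matrix.map_one _ Complex.ofReal_zero Complex.ofReal_one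
  constructor
  · rintro ⟨hO, ⟨γ, hγ⟩, hS⟩
    have hev : ∀ m, γ (-m) = γ m := fun m => by
      have h := congrFun (congrFun hS 0) m
      rw [Matrix.transpose_apply, hγ, hγ] at h
      simpa using h
    set l : ZMod N → ℂ := fun k => ∑ m, (γ m : ℂ) * ZMod.stdAddChar (m * k) with hl
    have hlneg : ∀ k, l (-k) = l k := fun k => by
      simp only [hl]
      rw [← Equiv.sum_comp (Equiv.neg (ZMod N))]
      simp [hev]
    have hlconj : ∀ k, (starRingEnd ℂ) (l k) = l k := fun k => by
      conv_rhs => rw [← hlneg k]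
      simp only [hl, map_sum, map_mul, Complex.conj_ofReal, conj_std, mul_neg]
    have hre : ∀ k, ((l k).re : ℂ) = l k := fun k => Complex.conj_eq_iff_re.1 (hlconj k)
    have hUF : U.map Complex.ofReal * Four N = Four N * Matrix.diagonal l := by
      ext i k
      rw [Matrix.mul_diagonal, Matrix.mul_apply, ← Equiv.sum_comp (Equiv.addRight i)]
      simp only [hl, Finset.mul_sum]
      refine Finset.sum_congr rfl fun m _ => ?_
      rw [Matrix.map_apply, hγ, Four_apply, Four_apply]
      simp only [Equiv.coe_addRight, add_sub_cancel_right, add_mul, AddChar.map_add_eq_mul]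
      ring
    have hUU : U.map Complex.ofReal * U.map Complex.ofReal = 1 := by
      rw [← hmul, ← hone]; rw [hS] at hO; rw [hO]
    have hD : Matrix.diagonal l * Matrix.diagonal l = 1 := by
      calc Matrix.diagonal l * Matrix.diagonal l
          = (Four N)ᴴ * Four N * Matrix.diagonal l * Matrix.diagonal l := by
            rw [FF', Matrix.one_mul]
        _ = (Four N)ᴴ * (U.map Complex.ofReal * (U.map Complex.ofReal * Four N)) := by
            rw [hUF, ← Matrix.mul_assoc (U.map _), hUF]; simp only [Matrix.mul_assoc]
        _ = 1 := by rw [← Matrix.mul_assoc (U.map _), hUU, Matrix.one_mul, FF']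
    refine ⟨fun k => (l k).re, fun k => ?_, fun k => by simp only [hlneg], ?_⟩
    · have h := congrFun (congrFun hD k) k
      rw [Matrix.diagonal_mul_diagonal, Matrix.diagonal_apply_eq, Matrix.one_apply_eq,
        ← hre] at h
      exact mul_self_eq_one_iff.1 (by exact_mod_cast h)
    · simp only [hre]
      rw [← hUF, Matrix.mul_assoc, FF, Matrix.mul_one]
  · rintro ⟨q, hq, hqe, hU⟩
    have hent : ∀ i j, ((U i j : ℝ) : ℂ) =
        (∑ k, (q k : ℂ) * ZMod.stdAddChar (k * (i - j))) / N := fun i j => by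
      rw [← FDF_apply, ← hU, Matrix.map_apply]
    have hS : Uᵀ = U := by
      ext i j
      apply Complex.ofReal_injective
      rw [Matrix.transpose_apply, hent, hent, ← Equiv.sum_comp (Equiv.neg (ZMod N))]
      congr 1
      refine Finset.sum_congr rfl fun k _ => ?_
      rw [Equiv.neg_apply, ← hqe, show -k * (j - i) = k * (i - j) by ring]
    refine ⟨?_, ⟨fun m => U 0 m, fun i j => ?_⟩, hS⟩
    · rw [hS]
      apply Matrix.map_injective Complex.ofReal_injective
      change (U * U).map Complex.ofReal = (1 : Matrix (ZMod N) (ZMod N) ℝ).map Complex.ofReal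
      rw [hmul, hone, hU]
      have hD : Matrix.diagonal (fun k => (q k : ℂ)) * Matrix.diagonal (fun k => (q k : ℂ)) = 1 := by
        rw [Matrix.diagonal_mul_diagonal, ← Matrix.diagonal_one]
        congr 1
        funext k
        rcases hq k with h | h <;> simp [h]
      calc _ = Four N * Matrix.diagonal (fun k => (q k : ℂ)) * ((Four N)ᴴ * Four N) *
            Matrix.diagonal (fun k => (q k : ℂ)) * (Four N)ᴴ := by simp only [Matrix.mul_assoc]
        _ = 1 := by
          rw [FF', Matrix.mul_one, Matrix.mul_assoc (Four N), hD, Matrix.mul_one, FF]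
    · apply Complex.ofReal_injective
      rw [hent, hent, zero_sub, neg_sub]
end

section
/- Let a,b,c ≥ 0 with N = a + 2b + c, let x,y ∈ ℝ be nonzero with opposite signs, and let U ∈ M_N({x,y}) be an orthogonal matrix coming from an (a,b,c) pattern. Then, with S_{ij} = sgn(U_{ij}), the matrix S Uᵗ is given by (S Uᵗ)_{ij} = (a+b)|x| + (b+c)|y| when i = j, and (S Uᵗ)_{ij} = (a−b)|x| + (c−b)|y| when i ≠ j. In particular S Uᵗ is symmetric. -/
open Matrix

lemma aux_card {N : ℕ} (p : Fin N → Prop) [DecidablePred p] (m : ℕ) (h : ({k | p k} : Set (Fin N)).ncard = m) (t : ℝ) :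
    ∑ k, (if p k then t else 0) = m * t := by
  rw [← h, ← Finset.sum_filter, Finset.sum_const, nsmul_eq_mul]
  congr 2
  rw [← Set.ncard_coe_finset]
  congr 1
  ext k
  simp

/-- If `U ∈ M_N({x,y})` is orthogonal and comes from an `(a,b,c)`
pattern (with `N = a+2b+c` and `x,y` nonzero of opposite signs), then with
`S_{ij} = sgn(U_{ij})` one has `(SUᵗ)_{ii} = (a+b)|x|+(b+c)|y|` and, for `i ≠ j`,
`(SUᵗ)_{ij} = (a-b)|x|+(c-b)|y|`; in particular `SUᵗ` is symmetric. -/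
theorem stmt7 (N a b c : ℕ) (hN : N = a + 2 * b + c) (x y : ℝ)
    (hx : x ≠ 0) (hy : y ≠ 0) (hxy : x * y < 0)
    (U : Matrix (Fin N) (Fin N) ℝ) (horth : U * Uᵀ = 1)
    (hval : ∀ i j, U i j = x ∨ U i j = y)
    (hrowx : ∀ i, ({k | U i k = x} : Set (Fin N)).ncard = a + b)
    (hrowy : ∀ i, ({k | U i k = y} : Set (Fin N)).ncard = b + c)
    (hxx : ∀ i j, i ≠ j → ({k | U i k = x ∧ U j k = x} : Set (Fin N)).ncard = a)
    (hxy2 : ∀ i j, i ≠ j → ({k | U i k = x ∧ U j k = y} : Set (Fin N)).ncard = b)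
    (hyx : ∀ i j, i ≠ j → ({k | U i k = y ∧ U j k = x} : Set (Fin N)).ncard = b)
    (hyy : ∀ i j, i ≠ j → ({k | U i k = y ∧ U j k = y} : Set (Fin N)).ncard = c)
    (S : Matrix (Fin N) (Fin N) ℝ) (hS : ∀ i j, S i j = Real.sign (U i j)) :
    (∀ i j, (S * Uᵀ) i j =
      if i = j then ((a : ℝ) + b) * |x| + ((b : ℝ) + c) * |y|
      else ((a : ℝ) - b) * |x| + ((c : ℝ) - b) * |y|) ∧
    (S * Uᵀ).IsSymm := by
  classical
  have hne : x ≠ y := by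
    rintro rfl
    nlinarith [mul_self_nonneg x]
  have sxx : Real.sign x * x = |x| := by
    rcases lt_or_gt_of_ne hx with h | h
    · rw [Real.sign_of_neg h, abs_of_neg h]; ring
    · rw [Real.sign_of_pos h, abs_of_pos h]; ring
  have syy : Real.sign y * y = |y| := by
    rcases lt_or_gt_of_ne hy with h | h
    · rw [Real.sign_of_neg h, abs_of_neg h]; ring
    · rw [Real.sign_of_pos h, abs_of_pos h]; ring
  have hs : Real.sign x = - Real.sign y := by
    rcases lt_or_gt_of_ne hx with h | h
    · have h2 : 0 < y := by
        by_contra h3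
        nlinarith [mul_nonneg_of_nonpos_of_nonpos h.le (not_lt.mp h3)]
      rw [Real.sign_of_neg h, Real.sign_of_pos h2]
    · have h2 : y < 0 := by
        by_contra h3
        nlinarith [mul_nonneg h.le (not_lt.mp h3)]
      rw [Real.sign_of_pos h, Real.sign_of_neg h2]; ring
  have sxy : Real.sign x * y = -|y| := by rw [hs, ← syy]; ring
  have syx : Real.sign y * x = -|x| := by rw [← sxx, hs]; ring
  have key : ∀ i j, (S * Uᵀ) i j =
      if i = j then ((a : ℝ) + b) * |x| + ((b : ℝ) + c) * |y|
      else ((a : ℝ) - b) * |x| + ((c : ℝ) - b) * |y| := by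
    intro i j
    simp only [Matrix.mul_apply, Matrix.transpose_apply, hS]
    split_ifs with hij
    · subst hij
      have e : ∀ k, Real.sign (U i k) * U i k =
          (if U i k = x then |x| else 0) + (if U i k = y then |y| else 0) := by
        intro k
        rcases hval i k with h | h <;> simp [h, hne, hne.symm, sxx, syy]
      simp only [e, Finset.sum_add_distrib]
      rw [aux_card _ _ (hrowx i), aux_card _ _ (hrowy i)]
      push_cast
      ring
    · have e : ∀ k, Real.sign (U i k) * U j k =
          (if U i k = x ∧ U j k = x then |x| else 0) + (if U i k = x ∧ U j k = y then -|y| else 0)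
          + (if U i k = y ∧ U j k = x then -|x| else 0)
          + (if U i k = y ∧ U j k = y then |y| else 0) := by
        intro k
        rcases hval i k with h | h <;> rcases hval j k with h' | h' <;>
          simp [h, h', hne, hne.symm, sxx, syy, sxy, syx]
      simp only [e, Finset.sum_add_distrib]
      rw [aux_card _ _ (hxx i j hij), aux_card _ _ (hxy2 i j hij), aux_card _ _ (hyx i j hij),
        aux_card _ _ (hyy i j hij)]
      ring
  refine ⟨key, ?_⟩
  ext i j
  rw [Matrix.transpose_apply, key, key]
  simp only [eq_comm]
end

section
/- Let a,c ≥ 0 and b ≥ 1 with N = a + 2b + c, let x < 0 < y, and let U ∈ M_N({x,y}) be an orthogonal matrix coming from an (a,b,c) pattern. Then, with S_{ij} = sgn(U_{ij}), one has the decomposition S Uᵗ = 2b(|x|+|y|)(1_N − J_N) + ((N(a−b)+2b)|x| + (N(c−b)+2b)|y|)·J_N, where J_N is the N×N matrix with all entries 1/N. Consequently S Uᵗ is positive definite (i.e. H = √N·U is almost Hadamard) if and only if (N(a−b)+2b)|x| + (N(c−b)+2b)|y| > 0. -/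
open Matrix

theorem aux_ncard (N : ℕ) (P : Fin N → Prop) [DecidablePred P] (m : ℕ)
    (h : ({k | P k} : Set (Fin N)).ncard = m) : ∑ k, (if P k then (1 : ℝ) else 0) = m := by
  rw [Finset.sum_boole, ← h]
  congr 1
  rw [← Set.ncard_coe_finset]
  simp

theorem aux_posdef (N : ℕ) (hN : 0 < N) (p q : ℝ) (hp : 0 < p)
    (J : Matrix (Fin N) (Fin N) ℝ) (hJ : ∀ i j, J i j = (N : ℝ)⁻¹) :
    (p • (1 - J) + q • J).PosDef ↔ 0 < q := by
  have hN' : (0 : ℝ) < N := by exact_mod_cast hN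
  have hJv : ∀ v : Fin N → ℝ, J *ᵥ v = fun _ => (N : ℝ)⁻¹ * ∑ i, v i := by
    intro v
    ext i
    simp [Matrix.mulVec, dotProduct, hJ, Finset.mul_sum]
  have key : ∀ v : Fin N → ℝ, v ⬝ᵥ ((p • (1 - J) + q • J) *ᵥ v)
      = p * (∑ i, v i ^ 2) + (q - p) * ((N : ℝ)⁻¹ * (∑ i, v i) ^ 2) := by
    intro v
    have h1 : v ⬝ᵥ (fun _ => (N : ℝ)⁻¹ * ∑ i, v i) = (N : ℝ)⁻¹ * (∑ i, v i) ^ 2 := by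
      simp only [dotProduct]
      rw [← Finset.sum_mul]
      ring
    have h2 : v ⬝ᵥ v = ∑ i, v i ^ 2 := by
      simp only [dotProduct, sq]
    rw [Matrix.add_mulVec, Matrix.smul_mulVec, Matrix.smul_mulVec, Matrix.sub_mulVec,
      Matrix.one_mulVec, hJv, dotProduct_add, dotProduct_smul, dotProduct_smul, dotProduct_sub,
      h1, h2, smul_eq_mul, smul_eq_mul]
    ring
  constructor
  · intro h
    have hne : (fun _ : Fin N => (1 : ℝ)) ≠ 0 := by
      intro h0
      have := congrFun h0 ⟨0, hN⟩
      simp at this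
    have h1 := h.dotProduct_mulVec_pos hne
    rw [star_trivial, key] at h1
    simp at h1
    have : p * (N : ℝ) + (q - p) * ((N : ℝ)⁻¹ * (N : ℝ) ^ 2) = q * N := by
      field_simp
      ring
    rw [this] at h1
    exact pos_of_mul_pos_left h1 hN'.le
  · intro hq
    refine Matrix.PosDef.of_dotProduct_mulVec_pos ?_ ?_
    · ext i j
      simp [hJ, Matrix.one_apply, eq_comm]
    · intro v hv
      rw [star_trivial, key]
      have hpos : 0 < ∑ i, v i ^ 2 := by
        obtain ⟨i, hi⟩ := Function.ne_iff.mp hv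
        exact Finset.sum_pos' (fun i _ => sq_nonneg _) ⟨i, Finset.mem_univ _, by
          have : v i ≠ 0 := hi
          positivity⟩
      have hcs : (N : ℝ)⁻¹ * (∑ i, v i) ^ 2 ≤ ∑ i, v i ^ 2 := by
        have := sq_sum_le_card_mul_sum_sq (s := Finset.univ) (f := v)
        simp only [Finset.card_univ, Fintype.card_fin] at this
        rw [inv_mul_le_iff₀ hN']
        exact this
      have h0 : 0 ≤ (N : ℝ)⁻¹ * (∑ i, v i) ^ 2 := by positivity
      generalize (N : ℝ)⁻¹ * (∑ i, v i) ^ 2 = t at *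
      generalize ∑ i, v i ^ 2 = r at *
      rcases h0.eq_or_lt with h0 | h0
      · rw [← h0]; nlinarith [mul_pos hp hpos]
      · nlinarith [mul_nonneg hp.le (sub_nonneg.2 hcs), mul_pos hq h0]

/-- If `U ∈ M_N({x,y})` is orthogonal, coming from an `(a,b,c)`
pattern with `b ≥ 1` and `x < 0 < y`, then with `S_{ij} = sgn(U_{ij})` one has
`SUᵗ = 2b(|x|+|y|)(1_N - J_N) + ((N(a-b)+2b)|x| + (N(c-b)+2b)|y|)·J_N`, where
`J_N` is the flat matrix with all entries `1/N`; consequently `SUᵗ` is positive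
definite (i.e. `√N·U` is almost Hadamard) iff
`(N(a-b)+2b)|x| + (N(c-b)+2b)|y| > 0`. -/
theorem stmt8 (N a b c : ℕ) (hN : N = a + 2 * b + c) (hb : 1 ≤ b) (x y : ℝ)
    (hx : x < 0) (hy : 0 < y)
    (U : Matrix (Fin N) (Fin N) ℝ) (horth : U * Uᵀ = 1)
    (hval : ∀ i j, U i j = x ∨ U i j = y)
    (hrowx : ∀ i, ({k | U i k = x} : Set (Fin N)).ncard = a + b)
    (hrowy : ∀ i, ({k | U i k = y} : Set (Fin N)).ncard = b + c)
    (hxx : ∀ i j, i ≠ j → ({k | U i k = x ∧ U j k = x} : Set (Fin N)).ncard = a)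
    (hxy2 : ∀ i j, i ≠ j → ({k | U i k = x ∧ U j k = y} : Set (Fin N)).ncard = b)
    (hyx : ∀ i j, i ≠ j → ({k | U i k = y ∧ U j k = x} : Set (Fin N)).ncard = b)
    (hyy : ∀ i j, i ≠ j → ({k | U i k = y ∧ U j k = y} : Set (Fin N)).ncard = c)
    (S : Matrix (Fin N) (Fin N) ℝ) (hS : ∀ i j, S i j = Real.sign (U i j))
    (J : Matrix (Fin N) (Fin N) ℝ) (hJ : ∀ i j, J i j = (N : ℝ)⁻¹) :
    S * Uᵀ = (2 * (b : ℝ) * (|x| + |y|)) • (1 - J) +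
        (((N : ℝ) * ((a : ℝ) - b) + 2 * b) * |x| +
          ((N : ℝ) * ((c : ℝ) - b) + 2 * b) * |y|) • J ∧
    ((S * Uᵀ).PosDef ↔
      0 < ((N : ℝ) * ((a : ℝ) - b) + 2 * b) * |x| +
            ((N : ℝ) * ((c : ℝ) - b) + 2 * b) * |y|) := by
  have hNpos : 0 < N := by omega
  have hN' : (0 : ℝ) < N := by exact_mod_cast hNpos
  have hb' : (0 : ℝ) < b := by exact_mod_cast hb
  have hne : x ≠ y := (hx.trans hy).ne
  have hsx : Real.sign x = -1 := Real.sign_of_neg hx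
  have hsy : Real.sign y = 1 := Real.sign_of_pos hy
  have hax : |x| = -x := abs_of_neg hx
  have hay : |y| = y := abs_of_pos hy
  have main : S * Uᵀ = (2 * (b : ℝ) * (|x| + |y|)) • (1 - J) +
        (((N : ℝ) * ((a : ℝ) - b) + 2 * b) * |x| +
          ((N : ℝ) * ((c : ℝ) - b) + 2 * b) * |y|) • J := by
    classical
    ext i j
    simp only [Matrix.mul_apply, Matrix.transpose_apply, Matrix.add_apply, Matrix.smul_apply,
      Matrix.sub_apply, hJ, hS, smul_eq_mul, hax, hay]
    by_cases hij : i = j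
    · subst hij
      have e : ∀ k, Real.sign (U i k) * U i k = (-x) * (if U i k = x then (1 : ℝ) else 0)
          + y * (if U i k = y then (1 : ℝ) else 0) := by
        intro k
        rcases hval i k with h | h <;> simp [h, hsx, hsy, hne, hne.symm]
      simp only [e, Finset.sum_add_distrib, ← Finset.mul_sum]
      rw [aux_ncard N _ _ (hrowx i), aux_ncard N _ _ (hrowy i), Matrix.one_apply_eq]
      push_cast
      field_simp
      ring
    · have e : ∀ k, Real.sign (U i k) * U j k =
          (-x) * (if U i k = x ∧ U j k = x then (1 : ℝ) else 0)
          + (-y) * (if U i k = x ∧ U j k = y then (1 : ℝ) else 0)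
          + x * (if U i k = y ∧ U j k = x then (1 : ℝ) else 0)
          + y * (if U i k = y ∧ U j k = y then (1 : ℝ) else 0) := by
        intro k
        rcases hval i k with h | h <;> rcases hval j k with h' | h' <;>
          simp [h, h', hsx, hsy, hne, hne.symm]
      simp only [e, Finset.sum_add_distrib, ← Finset.mul_sum]
      rw [aux_ncard N _ _ (hxx i j hij), aux_ncard N _ _ (hxy2 i j hij),
        aux_ncard N _ _ (hyx i j hij), aux_ncard N _ _ (hyy i j hij), Matrix.one_apply_ne hij]
      field_simp
      ring
  refine ⟨main, ?_⟩
  rw [main]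
  refine aux_posdef N hNpos _ _ ?_ J hJ
  rw [hax, hay]
  exact mul_pos (by linarith) (by linarith)
end

section
/- Let p ∈ [1,2) and let U ∈ O(N) be a local maximum on O(N) of the function V ↦ Σ_{ij} |V_{ij}|^p (i.e. there is a neighborhood of U in O(N) on which this function attains its maximum at U). Then all entries of U are nonzero. -/
open Matrix

lemma aux_conv (p : ℝ) (hp1 : 1 ≤ p) (x y : ℝ) :
    2 * |x| ^ p ≤ |x + y| ^ p + |x - y| ^ p := by
  have h1 : |x| ≤ (1/2) * |x + y| + (1/2) * |x - y| := by
    have := abs_add_le (x + y) (x - y)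
    have h2 : |x + y + (x - y)| = 2 * |x| := by
      rw [show x + y + (x - y) = 2 * x by ring, abs_mul]; norm_num
    linarith
  have h2 := (convexOn_rpow hp1).2 (Set.mem_Ici.mpr (abs_nonneg (x + y)))
    (Set.mem_Ici.mpr (abs_nonneg (x - y)))
    (by norm_num : (0:ℝ) ≤ 1/2) (by norm_num : (0:ℝ) ≤ 1/2) (by norm_num)
  simp only [smul_eq_mul] at h2
  have h3 := Real.rpow_le_rpow (abs_nonneg x) h1 (by linarith : 0 ≤ p)
  linarith

lemma aux_cos (p : ℝ) (hp1 : 1 ≤ p) (hp2 : p < 2) (c s a : ℝ) (hc0 : 0 < c) (hc1 : c ≤ 1)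
    (hcs : c ^ 2 + s ^ 2 = 1) :
    (1 - s ^ 2) * |a| ^ p ≤ |c * a| ^ p := by
  rw [abs_mul, Real.mul_rpow (abs_nonneg _) (abs_nonneg _), abs_of_pos hc0]
  apply mul_le_mul_of_nonneg_right _ (by positivity)
  have := Real.rpow_le_rpow_of_exponent_ge hc0 hc1 hp2.le
  rw [Real.rpow_two] at this
  linarith

lemma aux_T (p : ℝ) (hp1 : 1 ≤ p) (hp2 : p < 2) (c s a b : ℝ) (hc0 : 0 < c) (hc1 : c ≤ 1)
    (hcs : c ^ 2 + s ^ 2 = 1) :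
    2 * ((1 - s ^ 2) * (|a| ^ p + |b| ^ p)) ≤
    |c * a + s * b| ^ p + |c * b - s * a| ^ p + |c * a - s * b| ^ p + |c * b + s * a| ^ p := by
  have h1 := aux_cos p hp1 hp2 c s a hc0 hc1 hcs
  have h2 := aux_cos p hp1 hp2 c s b hc0 hc1 hcs
  have h3 := aux_conv p hp1 (c * a) (s * b)
  have h4 := aux_conv p hp1 (c * b) (s * a)
  linarith

lemma aux_T0 (p : ℝ) (hp1 : 1 ≤ p) (hp2 : p < 2) (c s b : ℝ) (hc0 : 0 < c) (hc1 : c ≤ 1)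
    (hs : 0 < s) (hcs : c ^ 2 + s ^ 2 = 1) :
    2 * ((1 - s ^ 2) * (|(0:ℝ)| ^ p + |b| ^ p)) + 2 * (s ^ p * |b| ^ p) ≤
    |c * 0 + s * b| ^ p + |c * b - s * 0| ^ p + |c * 0 - s * b| ^ p + |c * b + s * 0| ^ p := by
  have h2 := aux_cos p hp1 hp2 c s b hc0 hc1 hcs
  have h3 : |s * b| ^ p = s ^ p * |b| ^ p := by
    rw [abs_mul, Real.mul_rpow (abs_nonneg _) (abs_nonneg _), abs_of_pos hs]
  have h0 : |(0:ℝ)| ^ p = 0 := by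
    rw [abs_zero, Real.zero_rpow (by linarith)]
  simp only [mul_zero, zero_add, zero_sub, add_zero, sub_zero, abs_neg, h3, h0]
  linarith

def rotM {N : ℕ} (U : Matrix (Fin N) (Fin N) ℝ) (i k : Fin N) (c s : ℝ) :
    Matrix (Fin N) (Fin N) ℝ :=
  fun x j => if x = i then c * U i j + s * U k j else if x = k then c * U k j - s * U i j
    else U x j

lemma rotM_orth {N : ℕ} (U : Matrix (Fin N) (Fin N) ℝ) (hU : U * Uᵀ = 1) (i k : Fin N)
    (hik : i ≠ k) (c s : ℝ) (hcs : c ^ 2 + s ^ 2 = 1) :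
    rotM U i k c s * (rotM U i k c s)ᵀ = 1 := by
  have h : ∀ x y, U x ⬝ᵥ U y = if x = y then 1 else 0 := by
    intro x y
    have := congrFun (congrFun hU x) y
    rw [Matrix.one_apply] at this
    exact this
  have hr : ∀ x, rotM U i k c s x = if x = i then c • U i + s • U k else
      if x = k then c • U k - s • U i else U x := by
    intro x
    ext j
    unfold rotM
    split_ifs <;> simp
  ext x y
  rw [Matrix.one_apply]
  change rotM U i k c s x ⬝ᵥ rotM U i k c s y = _
  rw [hr, hr]
  have hki := hik.symm
  split_ifs <;> subst_vars <;>
    simp_all [add_dotProduct, dotProduct_add, sub_dotProduct, dotProduct_sub, eq_comm] <;>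
    linarith

lemma rotM_sum {N : ℕ} (p : ℝ) (U : Matrix (Fin N) (Fin N) ℝ) (i k : Fin N)
    (hik : i ≠ k) (c s : ℝ) :
    (∑ x, ∑ j, |rotM U i k c s x j| ^ p) + (∑ x, ∑ j, |rotM U i k c (-s) x j| ^ p)
      - 2 * (∑ x, ∑ j, |U x j| ^ p) =
    ∑ j, (|c * U i j + s * U k j| ^ p + |c * U k j - s * U i j| ^ p
      + |c * U i j - s * U k j| ^ p + |c * U k j + s * U i j| ^ p
      - 2 * (|U i j| ^ p + |U k j| ^ p)) := by
  rw [Finset.mul_sum, ← Finset.sum_add_distrib, ← Finset.sum_sub_distrib,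
    Fintype.sum_eq_add i k hik]
  · simp only [Finset.mul_sum, ← Finset.sum_add_distrib, ← Finset.sum_sub_distrib]
    apply Finset.sum_congr rfl
    intro j _
    simp only [rotM, if_true, hik.symm, if_false, neg_mul, sub_neg_eq_add, ← sub_eq_add_neg]
    ring
  · rintro x ⟨h1, h2⟩
    simp only [rotM, h1, h2, if_false]
    ring

/-- If `p ∈ [1,2)` and `U ∈ O(N)` is a local maximum of the
`p`-norm functional `V ↦ Σ_{ij} |V_{ij}|^p` on `O(N)`, then all entries of `U`
are nonzero. -/
theorem stmt14 (N : ℕ) (p : ℝ) (hp1 : 1 ≤ p) (hp2 : p < 2)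
    (U : Matrix (Fin N) (Fin N) ℝ) (hU : U * Uᵀ = 1)
    (hmax : IsLocalMaxOn
      (fun V : Matrix (Fin N) (Fin N) ℝ => ∑ i, ∑ j, |V i j| ^ p)
      {V : Matrix (Fin N) (Fin N) ℝ | V * Vᵀ = 1} U) :
    ∀ i j, U i j ≠ 0 := by
  intro i j₀ h0
  obtain ⟨k, hk⟩ : ∃ k, U k j₀ ≠ 0 := by
    by_contra! hcon
    have h1 : Uᵀ * U = 1 := mul_eq_one_comm.mp hU
    have := congrFun (congrFun h1 j₀) j₀
    simp [Matrix.mul_apply, hcon] at this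
  have hik : i ≠ k := by rintro rfl; exact hk h0
  -- the path
  have hev : ∀ᶠ t in nhds (0:ℝ), ∑ x, ∑ j, |rotM U i k (Real.cos t) (Real.sin t) x j| ^ p
      ≤ ∑ x, ∑ j, |U x j| ^ p := by
    have hc : Continuous (fun t : ℝ => rotM U i k (Real.cos t) (Real.sin t)) := by
      refine continuous_pi fun x => continuous_pi fun j => ?_
      unfold rotM
      split_ifs <;> fun_prop
    have hz : rotM U i k (Real.cos 0) (Real.sin 0) = U := by
      ext x j
      unfold rotM
      split_ifs <;> simp_all
    have ht : Filter.Tendsto (fun t : ℝ => rotM U i k (Real.cos t) (Real.sin t)) (nhds 0)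
        (nhdsWithin U {V : Matrix (Fin N) (Fin N) ℝ | V * Vᵀ = 1}) := by
      apply tendsto_nhdsWithin_iff.mpr
      refine ⟨?_, Filter.Eventually.of_forall fun t => ?_⟩
      · have := hc.tendsto 0
        rwa [hz] at this
      · exact rotM_orth U hU i k hik _ _ (Real.cos_sq_add_sin_sq t)
    exact ht.eventually hmax
  have hev2 : ∀ᶠ t in nhds (0:ℝ),
      ∑ x, ∑ j, |rotM U i k (Real.cos t) (-Real.sin t) x j| ^ p ≤ ∑ x, ∑ j, |U x j| ^ p := by
    have hn : Filter.Tendsto (fun t : ℝ => -t) (nhds 0) (nhds 0) := by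
      simpa using (continuous_neg (G := ℝ)).tendsto 0
    have := hn.eventually hev
    simpa only [Real.cos_neg, Real.sin_neg] using this
  set M : ℝ := ∑ j, (|U i j| ^ p + |U k j| ^ p) with hM
  have hb : 0 < |U k j₀| ^ p := Real.rpow_pos_of_pos (abs_pos.mpr hk) p
  have hev3 : ∀ᶠ t in nhds (0:ℝ), (Real.sin t) ^ (2 - p) * M < |U k j₀| ^ p := by
    have hc : Continuous (fun t : ℝ => (Real.sin t) ^ (2 - p) * M) :=
      (Real.continuous_sin.rpow_const (fun _ => Or.inr (by linarith))).mul continuous_const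
    have := hc.tendsto 0
    simp only [Real.sin_zero] at this
    rw [Real.zero_rpow (by linarith), zero_mul] at this
    exact this.eventually (gt_mem_nhds hb)
  have hev4 : ∀ᶠ t in nhds (0:ℝ), t < 1 := gt_mem_nhds one_pos
  have hall := ((hev.and hev2).and (hev3.and hev4)).filter_mono
    (nhdsWithin_le_nhds (s := Set.Ioi (0:ℝ)))
  obtain ⟨t, ⟨⟨h1, h2⟩, h3, h4⟩, ht0⟩ := (hall.and self_mem_nhdsWithin).exists
  have ht0 : 0 < t := ht0
  have hpi := Real.pi_gt_three
  have hs : 0 < Real.sin t := Real.sin_pos_of_pos_of_lt_pi ht0 (by linarith)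
  have hc : 0 < Real.cos t := Real.cos_pos_of_mem_Ioo ⟨by linarith, by linarith⟩
  have hcs := Real.cos_sq_add_sin_sq t
  have hc1 := Real.cos_le_one t
  generalize Real.sin t = s at *
  generalize Real.cos t = c at *
  have hsum := rotM_sum p U i k hik c s
  have hlow : ∑ j, (-2 * s ^ 2 * (|U i j| ^ p + |U k j| ^ p) +
      if j = j₀ then 2 * (s ^ p * |U k j₀| ^ p) else 0) ≤
      ∑ j, (|c * U i j + s * U k j| ^ p + |c * U k j - s * U i j| ^ p
      + |c * U i j - s * U k j| ^ p + |c * U k j + s * U i j| ^ p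
      - 2 * (|U i j| ^ p + |U k j| ^ p)) := by
    apply Finset.sum_le_sum
    intro j _
    split_ifs with hj
    · subst hj
      have := aux_T0 p hp1 hp2 c s (U k j) hc hc1 hs hcs
      rw [h0]
      linarith
    · have := aux_T p hp1 hp2 c s (U i j) (U k j) hc hc1 hcs
      linarith
  rw [Finset.sum_add_distrib, ← Finset.mul_sum, ← hM, Finset.sum_ite_eq' Finset.univ j₀,
    if_pos (Finset.mem_univ _)] at hlow
  have hsp : s ^ p * s ^ (2 - p) = s ^ 2 := by
    rw [← Real.rpow_add hs, ← Real.rpow_two]; congr 1; ring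
  have hspos : 0 < s ^ p := Real.rpow_pos_of_pos hs p
  have := mul_lt_mul_of_pos_left h3 hspos
  rw [← mul_assoc, hsp] at this
  linarith
end

section
/- Let A ∈ O(N) be a real orthogonal matrix that is antisymmetric (Aᵗ = −A). Then for every p ∈ [1,2), A is not a local maximum on O(N) of the function V ↦ Σ_{ij}|V_{ij}|^p, and for every p ∈ (2,∞), A is not a local minimum on O(N) of the function V ↦ Σ_{ij}|V_{ij}|^p. In particular, A is never a rescaled p-almost Hadamard matrix. -/
open Matrix

open Filter Topology in
lemma aux_sum (N : ℕ) (A : Matrix (Fin N) (Fin N) ℝ) (hAs : Aᵀ = -A) (p : ℝ) (hp : 1 ≤ p)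
    (c s : ℝ) (hc : 0 < c) (hs : 0 < s) :
    ∑ i, ∑ j, |(c • A - s • (1 : Matrix (Fin N) (Fin N) ℝ)) i j| ^ p
      = c ^ p * (∑ i, ∑ j, |A i j| ^ p) + N * s ^ p := by
  have hd : ∀ i, A i i = 0 := by
    intro i
    have := congrFun (congrFun hAs i) i
    simp only [Matrix.transpose_apply, Matrix.neg_apply] at this
    linarith
  have h : ∀ i j, |(c • A - s • (1 : Matrix (Fin N) (Fin N) ℝ)) i j| ^ p
      = c ^ p * |A i j| ^ p + if i = j then s ^ p else 0 := by
    intro i j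
    by_cases hij : i = j
    · subst hij
      have hp0 : p ≠ 0 := by linarith
      simp [hd, abs_of_pos hs, Real.zero_rpow hp0]
    · simp [hij, abs_mul, abs_of_pos hc, Real.mul_rpow hc.le (abs_nonneg _)]
  simp only [h, Finset.sum_add_distrib, Finset.mul_sum]
  simp

lemma aux_orth (N : ℕ) (A : Matrix (Fin N) (Fin N) ℝ) (hA : A * Aᵀ = 1) (hAs : Aᵀ = -A)
    (c s : ℝ) (h : c ^ 2 + s ^ 2 = 1) :
    (c • A - s • (1 : Matrix (Fin N) (Fin N) ℝ))
      * (c • A - s • (1 : Matrix (Fin N) (Fin N) ℝ))ᵀ = 1 := by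
  have hAA : A * A = -1 := by
    rw [hAs, mul_neg] at hA
    rw [← hA, neg_neg]
  rw [Matrix.transpose_sub, Matrix.transpose_smul, Matrix.transpose_smul, hAs,
    Matrix.transpose_one]
  have : (c • A - s • (1 : Matrix (Fin N) (Fin N) ℝ)) * (c • (-A) - s • 1)
      = (c ^ 2 + s ^ 2) • (1 : Matrix (Fin N) (Fin N) ℝ) := by
    simp only [sub_mul, mul_sub, smul_mul_assoc, mul_smul_comm, mul_neg, hAA, mul_one, one_mul]
    module
  rw [this, h, one_smul]

open Filter Topology in
lemma aux_tendsto (N : ℕ) (A : Matrix (Fin N) (Fin N) ℝ) (hA : A * Aᵀ = 1) (hAs : Aᵀ = -A) :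
    Tendsto (fun t : ℝ => Real.cos t • A - Real.sin t • (1 : Matrix (Fin N) (Fin N) ℝ))
      (𝓝[>] 0) (𝓝[{V : Matrix (Fin N) (Fin N) ℝ | V * Vᵀ = 1}] A) := by
  apply tendsto_nhdsWithin_of_tendsto_nhds_of_eventually_within
  · have hc : Continuous (fun t : ℝ =>
        Real.cos t • A - Real.sin t • (1 : Matrix (Fin N) (Fin N) ℝ)) := by fun_prop
    have := hc.tendsto 0
    simp only [Real.cos_zero, Real.sin_zero, one_smul, zero_smul, sub_zero] at this
    exact this.mono_left nhdsWithin_le_nhds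
  · filter_upwards with t
    exact aux_orth N A hA hAs _ _ (Real.cos_sq_add_sin_sq t)

open Filter Topology in
lemma aux_pos : ∀ᶠ t : ℝ in 𝓝[>] 0, 0 < Real.sin t ∧ 0 < Real.cos t := by
  filter_upwards [Ioo_mem_nhdsGT (show (0 : ℝ) < 1 by norm_num)] with t ht
  have := Real.pi_gt_three
  exact ⟨Real.sin_pos_of_pos_of_lt_pi ht.1 (by linarith [ht.2]),
    Real.cos_pos_of_mem_Ioo ⟨by linarith [ht.1], by linarith [ht.2]⟩⟩

open Filter Topology in
lemma aux_small (C D q : ℝ) (hq : 0 < q) (hD : 0 < D) :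
    ∀ᶠ t : ℝ in 𝓝[>] 0, C * Real.sin t ^ q < D := by
  have hc : Continuous (fun t : ℝ => C * Real.sin t ^ q) :=
    continuous_const.mul (Real.continuous_sin.rpow_const (fun _ => Or.inr hq.le))
  have := (hc.tendsto 0).eventually_lt_const (u := D) ((by simpa [Real.zero_rpow hq.ne'] using hD))
  exact this.filter_mono nhdsWithin_le_nhds

/-- An antisymmetric orthogonal matrix `A ∈ O(N)` is never a local
maximum of the `p`-norm on `O(N)` for `p ∈ [1,2)`, and never a local minimum of
the `p`-norm on `O(N)` for `p ∈ (2,∞)`; in particular it is never a rescaled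
`p`-almost Hadamard matrix. -/
theorem stmt15 (N : ℕ) (hN : 1 ≤ N) (A : Matrix (Fin N) (Fin N) ℝ)
    (hA : A * Aᵀ = 1) (hAs : Aᵀ = -A) :
    (∀ p : ℝ, 1 ≤ p → p < 2 →
      ¬ IsLocalMaxOn
          (fun V : Matrix (Fin N) (Fin N) ℝ => ∑ i, ∑ j, |V i j| ^ p)
          {V : Matrix (Fin N) (Fin N) ℝ | V * Vᵀ = 1} A) ∧
    (∀ p : ℝ, 2 < p →
      ¬ IsLocalMinOn
          (fun V : Matrix (Fin N) (Fin N) ℝ => ∑ i, ∑ j, |V i j| ^ p)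
          {V : Matrix (Fin N) (Fin N) ℝ | V * Vᵀ = 1} A) := by
  have hNR : (0 : ℝ) < N := by exact_mod_cast hN
  have hlim := aux_tendsto N A hA hAs
  constructor
  · intro p hp1 hp2 hmax
    obtain ⟨t, h1, ⟨hs, hc⟩, h3⟩ := ((hlim.eventually hmax).and
      (aux_pos.and (aux_small (∑ i, ∑ j, |A i j| ^ p) N (2 - p) (by linarith) hNR))).exists
    simp only at h1
    rw [aux_sum N A hAs p hp1 _ _ hc hs] at h1
    have hS : 0 ≤ ∑ i, ∑ j, |A i j| ^ p :=
      Finset.sum_nonneg fun i _ => Finset.sum_nonneg fun j _ => Real.rpow_nonneg (abs_nonneg _) _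
    set S := ∑ i, ∑ j, |A i j| ^ p
    have hcp : Real.cos t ^ 2 ≤ Real.cos t ^ p := by
      rw [← Real.rpow_two]
      exact Real.rpow_le_rpow_of_exponent_ge hc (Real.cos_le_one t) hp2.le
    have hsp : Real.sin t ^ (2 - p) * Real.sin t ^ p = Real.sin t ^ 2 := by
      rw [← Real.rpow_add hs, ← Real.rpow_two]; congr 1; ring
    have h4 := mul_lt_mul_of_pos_right h3 (Real.rpow_pos_of_pos hs p)
    rw [mul_assoc, hsp] at h4
    have h5 := mul_le_mul_of_nonneg_right hcp hS
    have h6 : Real.cos t ^ 2 * S + S * Real.sin t ^ 2 = S := by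
      rw [mul_comm S, ← add_mul, Real.cos_sq_add_sin_sq, one_mul]
    linarith
  · intro p hp2 hmin
    have hS : 0 < ∑ i, ∑ j, |A i j| ^ p := by
      have hne : A ≠ 0 := by
        rintro rfl
        have := congrFun (congrFun hA ⟨0, hN⟩) ⟨0, hN⟩
        simp at this
      obtain ⟨i, j, hij⟩ : ∃ i j, A i j ≠ 0 := by
        by_contra! h
        exact hne (by ext i j; exact h i j)
      refine Finset.sum_pos' (fun i _ => Finset.sum_nonneg fun j _ =>
        Real.rpow_nonneg (abs_nonneg _) _) ⟨i, Finset.mem_univ _, ?_⟩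
      exact Finset.sum_pos' (fun j _ => Real.rpow_nonneg (abs_nonneg _) _)
        ⟨j, Finset.mem_univ _, Real.rpow_pos_of_pos (abs_pos.mpr hij) _⟩
    obtain ⟨t, h1, ⟨hs, hc⟩, h3⟩ := ((hlim.eventually hmin).and
      (aux_pos.and (aux_small N (∑ i, ∑ j, |A i j| ^ p) (p - 2) (by linarith) hS))).exists
    simp only at h1
    rw [aux_sum N A hAs p (by linarith) _ _ hc hs] at h1
    set S := ∑ i, ∑ j, |A i j| ^ p
    have hcp : Real.cos t ^ p ≤ Real.cos t ^ 2 := by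
      rw [← Real.rpow_two]
      exact Real.rpow_le_rpow_of_exponent_ge hc (Real.cos_le_one t) hp2.le
    have hsp : Real.sin t ^ (p - 2) * Real.sin t ^ 2 = Real.sin t ^ p := by
      rw [← Real.rpow_two, ← Real.rpow_add hs]; congr 1; ring
    have h4 := mul_lt_mul_of_pos_right h3 (pow_pos hs 2)
    rw [mul_assoc, hsp] at h4
    have h5 := mul_le_mul_of_nonneg_right hcp hS.le
    have h6 : Real.cos t ^ 2 * S + S * Real.sin t ^ 2 = S := by
      rw [mul_comm S, ← add_mul, Real.cos_sq_add_sin_sq, one_mul]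
    linarith
end

section
/- Let U ∈ O(N) be a real orthogonal matrix with all entries nonzero, let p ∈ [1,∞), and define for an antisymmetric matrix A the quantity φ(A) = Σ_{ij} |U_{ij}|^{p−2}·((p−1)(UA)_{ij}² + U_{ij}(UA²)_{ij}). Define the tensor Y_{ab,cd} = δ_{bd}·Σ_i((p−1)|U_{ib}|^{p−2} − |U_{ic}|^{p−2})U_{ia}U_{ic} − δ_{bc}·Σ_i((p−1)|U_{ib}|^{p−2} − |U_{id}|^{p−2})U_{ia}U_{id} − δ_{ad}·Σ_i((p−1)|U_{ia}|^{p−2} − |U_{ic}|^{p−2})U_{ib}U_{ic} + δ_{ac}·Σ_i((p−1)|U_{ia}|^{p−2} − |U_{id}|^{p−2})U_{ib}U_{id}. Then for every B ∈ M_N(ℝ), setting A = B − Bᵗ, one has φ(A) = Σ_{a,b,c,d} Y_{ab,cd}·B_{ab}·B_{cd}. -/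
open Matrix

theorem aux_rhs (N : ℕ) (K : Fin N → Fin N → Fin N → ℝ) (B : Matrix (Fin N) (Fin N) ℝ) :
    (∑ a, ∑ b, ∑ c, ∑ d, ((if b = d then K a b c else 0) - (if b = c then K a b d else 0)
      - (if a = d then K b a c else 0) + (if a = c then K b a d else 0)) * B a b * B c d)
    = ∑ a, ∑ b, ∑ c, K a b c * ((B - Bᵀ) a b * (B - Bᵀ) c b) := by
  have h1 : ∀ a b, (∑ c, ∑ d, ((if b = d then K a b c else 0) - (if b = c then K a b d else 0)
      - (if a = d then K b a c else 0) + (if a = c then K b a d else 0)) * B a b * B c d)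
      = (∑ c, K a b c * (B a b * B c b - B a b * B b c))
        + ∑ c, K b a c * (B a b * B a c - B a b * B c a) := by
    intro a b
    simp only [add_mul, sub_mul, ite_mul, zero_mul, Finset.sum_add_distrib,
      Finset.sum_sub_distrib, mul_sub]
    have e2 : (∑ c, ∑ d, if b = c then K a b d * B a b * B c d else 0)
        = ∑ d, K a b d * B a b * B b d := by
      rw [Finset.sum_comm]; simp
    have e4 : (∑ c, ∑ d, if a = c then K b a d * B a b * B c d else 0)
        = ∑ d, K b a d * B a b * B a d := by
      rw [Finset.sum_comm]; simp
    rw [e2, e4]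
    simp only [Finset.sum_ite_eq, Finset.mem_univ, if_true, mul_assoc]
    ring
  simp only [h1, Finset.sum_add_distrib]
  rw [Finset.sum_comm (f := fun a b => ∑ c, K b a c * (B a b * B a c - B a b * B c a))]
  simp only [← Finset.sum_add_distrib]
  refine Finset.sum_congr rfl fun a _ => Finset.sum_congr rfl fun b _ =>
    Finset.sum_congr rfl fun c _ => ?_
  simp only [Matrix.sub_apply, Matrix.transpose_apply]
  ring

theorem aux_lhs (N : ℕ) (q : ℝ) (U w A : Matrix (Fin N) (Fin N) ℝ) (hA : ∀ i j, A i j = - A j i) :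
    (∑ i, ∑ j, w i j * (q * ((U * A) i j) ^ 2 + U i j * (U * A * A) i j))
    = ∑ a, ∑ b, ∑ c, (∑ i, (q * w i b - w i c) * U i a * U i c) * (A a b * A c b) := by
  have h1 : ∀ i j, w i j * (q * ((U * A) i j) ^ 2)
      = ∑ a, ∑ c, q * w i j * U i a * U i c * (A a j * A c j) := by
    intro i j
    rw [Matrix.mul_apply, sq, Finset.sum_mul_sum, Finset.mul_sum, Finset.mul_sum]
    refine Finset.sum_congr rfl fun a _ => ?_
    rw [Finset.mul_sum, Finset.mul_sum]
    refine Finset.sum_congr rfl fun c _ => ?_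
    ring
  have h2 : ∀ i j, w i j * (U i j * (U * A * A) i j)
      = ∑ b, ∑ a, - (w i j * U i a * U i j * (A a b * A j b)) := by
    intro i j
    rw [Matrix.mul_apply, Finset.mul_sum, Finset.mul_sum]
    refine Finset.sum_congr rfl fun b _ => ?_
    rw [Matrix.mul_apply, Finset.sum_mul, Finset.mul_sum, Finset.mul_sum]
    refine Finset.sum_congr rfl fun a _ => ?_
    rw [hA b j]
    ring
  have h3 : ∀ i, (∑ j, w i j * (q * ((U * A) i j) ^ 2 + U i j * (U * A * A) i j))
      = ∑ a, ∑ b, ∑ c, (q * w i b - w i c) * U i a * U i c * (A a b * A c b) := by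
    intro i
    simp only [mul_add, h1, h2, Finset.sum_add_distrib]
    rw [Finset.sum_comm (f := fun j a => ∑ c, q * w i j * U i a * U i c * (A a j * A c j))]
    have : (∑ j, ∑ b, ∑ a, - (w i j * U i a * U i j * (A a b * A j b)))
        = ∑ a, ∑ b, ∑ j, - (w i j * U i a * U i j * (A a b * A j b)) := by
      rw [Finset.sum_comm, Finset.sum_comm (s := Finset.univ (α := Fin N))
        (f := fun a b => ∑ j, - (w i j * U i a * U i j * (A a b * A j b)))]
      exact Finset.sum_congr rfl fun b _ => Finset.sum_comm
    rw [this]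
    simp only [← Finset.sum_add_distrib]
    refine Finset.sum_congr rfl fun a _ => Finset.sum_congr rfl fun b _ =>
      Finset.sum_congr rfl fun c _ => ?_
    ring
  simp only [h3, Finset.sum_mul]
  rw [Finset.sum_comm]
  refine Finset.sum_congr rfl fun a _ => ?_
  rw [Finset.sum_comm]
  refine Finset.sum_congr rfl fun b _ => ?_
  rw [Finset.sum_comm]

/-- For `U ∈ O(N)` with nonzero entries and `p ∈ [1,∞)`, the
Hessian quantity `φ(A) = Σ_{ij} |U_{ij}|^{p-2}((p-1)(UA)_{ij}² + U_{ij}(UA²)_{ij})`,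
evaluated at the antisymmetric matrix `A = B - Bᵗ`, equals the quadratic form
`Σ_{abcd} Y_{ab,cd} B_{ab} B_{cd}` for the tensor `Y` defined in the statement. -/
theorem stmt18 (N : ℕ) (U : Matrix (Fin N) (Fin N) ℝ) (hU : U * Uᵀ = 1)
    (hU0 : ∀ i j, U i j ≠ 0) (p : ℝ) (hp : 1 ≤ p)
    (Y : Fin N → Fin N → Fin N → Fin N → ℝ)
    (hY : ∀ a b c d, Y a b c d =
      (if b = d then
        ∑ i, ((p - 1) * |U i b| ^ (p - 2) - |U i c| ^ (p - 2)) * U i a * U i c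
       else 0)
      - (if b = c then
        ∑ i, ((p - 1) * |U i b| ^ (p - 2) - |U i d| ^ (p - 2)) * U i a * U i d
       else 0)
      - (if a = d then
        ∑ i, ((p - 1) * |U i a| ^ (p - 2) - |U i c| ^ (p - 2)) * U i b * U i c
       else 0)
      + (if a = c then
        ∑ i, ((p - 1) * |U i a| ^ (p - 2) - |U i d| ^ (p - 2)) * U i b * U i d
       else 0)) :
    ∀ B : Matrix (Fin N) (Fin N) ℝ,
      (∑ i, ∑ j, |U i j| ^ (p - 2) *
        ((p - 1) * ((U * (B - Bᵀ)) i j) ^ 2 +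
          U i j * (U * (B - Bᵀ) * (B - Bᵀ)) i j)) =
      ∑ a, ∑ b, ∑ c, ∑ d, Y a b c d * B a b * B c d := by
  intro B
  simp only [hY]
  rw [aux_rhs N (fun a b c =>
    ∑ i, ((p - 1) * |U i b| ^ (p - 2) - |U i c| ^ (p - 2)) * U i a * U i c) B]
  exact aux_lhs N (p - 1) U (fun i j => |U i j| ^ (p - 2)) (B - Bᵀ) (by
    intro i j
    simp)
end
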